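/- arXiv:2410.13728 — 2 statements merged into one kernel-verified Lean document; each statement's English description precedes it below -/
import Mathlib

section
/- Let A be a Deligne-finite k-linear abelian category over an algebraically closed field k, with a fixed ordering S_1,…,S_n of its simple objects, projective covers P_i, standard objects Δ_i and costandard objects ∇_i. Then A is highest weight with respect to the given ordering if, and only if, for each i = 1,…,n one has [Δ_i : S_i] = 1 and the identity [P_i] = Σ_{j=i}^{n} [∇_j : S_i] · [Δ_j] holds in the Grothendieck group K(A). -/
open CategoryTheory CategoryTheory.Limits

universe v u

namespace HWPaper

variable {C : Type u} [Category.{v} C]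

/-- `p : P ⟶ X` exhibits `P` as a projective cover of `X`:
`P` is projective, `p` is epi, and `p` is a superfluous epimorphism. -/
def IsProjCover (P X : C) (p : P ⟶ X) : Prop :=
  Projective P ∧ Epi p ∧ ∀ ⦃Y : C⦄ (f : Y ⟶ P), Epi (f ≫ p) → Epi f

/-- `ι : X ⟶ I` exhibits `I` as an injective hull of `X`. -/
def IsInjHull (X I : C) (ι : X ⟶ I) : Prop :=
  Injective I ∧ Mono ι ∧ ∀ ⦃Y : C⦄ (f : I ⟶ Y), Mono (ι ≫ f) → Mono f

/-- `q : P ⟶ D` exhibits `D` as the maximal quotient of `P` lying in the class `mem`: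
every quotient of `P` lying in `mem` factors through `q`. -/
def IsMaxQuotientIn (mem : C → Prop) (P D : C) (q : P ⟶ D) : Prop :=
  Epi q ∧ mem D ∧ ∀ ⦃Q : C⦄ (e : P ⟶ Q), Epi e → mem Q → ∃ r : D ⟶ Q, q ≫ r = e

/-- `m : N ⟶ I` exhibits `N` as the maximal subobject of `I` lying in the class `mem`. -/
def IsMaxSubobjectIn (mem : C → Prop) (I N : C) (m : N ⟶ I) : Prop :=
  Mono m ∧ mem N ∧ ∀ ⦃M : C⦄ (s : M ⟶ I), Mono s → mem M → ∃ r : M ⟶ N, r ≫ m = s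

/-- The extension closure of a class of objects in an abelian category. -/
inductive ExtClosure [Abelian C] (P : C → Prop) : C → Prop
  | of (X : C) : P X → ExtClosure P X
  | zero (X : C) : IsZero X → ExtClosure P X
  | ext (S : ShortComplex C) : S.ShortExact → ExtClosure P S.X₁ → ExtClosure P S.X₃ →
      ExtClosure P S.X₂

variable (C) in
/-- The subgroup of relations coming from short exact sequences. -/
def K0Relations [Abelian C] : AddSubgroup (FreeAbelianGroup C) :=
  AddSubgroup.closure {x | ∃ S : ShortComplex C, S.ShortExact ∧
    x = FreeAbelianGroup.of S.X₂ - FreeAbelianGroup.of S.X₁ - FreeAbelianGroup.of S.X₃}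

variable (C) in
/-- The Grothendieck group of an abelian category. -/
def K0 [Abelian C] : Type u := FreeAbelianGroup C ⧸ K0Relations C

noncomputable instance [Abelian C] : AddCommGroup (K0 C) :=
  QuotientAddGroup.Quotient.addCommGroup _

/-- The class of an object in the Grothendieck group. -/
def K0.cls [Abelian C] (X : C) : K0 C := QuotientAddGroup.mk (FreeAbelianGroup.of X)

/-- The data of a Deligne-finite `k`-linear abelian category with an ordering
`S 0, …, S (n-1)` of its simple objects, together with projective covers, injective hulls,
standard and costandard objects, and the Jordan–Hölder multiplicity function. -/
structure DeligneData (k : Type v) [Field k] [IsAlgClosed k]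
    (C : Type u) [Category.{v} C] [Abelian C] [Linear k C] [EnoughProjectives C]
    (n : ℕ) where
  /-- the simple objects -/
  S : Fin n → C
  /-- the projective covers -/
  P : Fin n → C
  /-- the injective hulls -/
  I : Fin n → C
  /-- the standard objects -/
  Δ : Fin n → C
  /-- the costandard objects -/
  nabla : Fin n → C
  /-- the projective cover maps -/
  p : ∀ i, P i ⟶ S i
  /-- the injective hull maps -/
  ι : ∀ i, S i ⟶ I i
  /-- the quotient maps onto the standard objects -/
  q : ∀ i, P i ⟶ Δ i
  /-- the inclusions of the costandard objects -/
  m : ∀ i, nabla i ⟶ I i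
  /-- the Jordan–Hölder multiplicity `[X : S j]` -/
  mult : C → Fin n → ℕ
  homFinite : ∀ X Y : C, FiniteDimensional k (X ⟶ Y)
  ext1Finite : ∀ X Y : C, FiniteDimensional k (((Ext k C 1).obj (Opposite.op X)).obj Y)
  simple : ∀ i, Simple (S i)
  distinct : ∀ i j, Nonempty (S i ≅ S j) → i = j
  exhaustive : ∀ X : C, Simple X → ∃ i, Nonempty (X ≅ S i)
  projCover : ∀ i, IsProjCover (P i) (S i) (p i)
  injHull : ∀ i, IsInjHull (S i) (I i) (ι i)
  std : ∀ i, IsMaxQuotientIn (ExtClosure (fun X => ∃ j, j ≤ i ∧ Nonempty (X ≅ S j)))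
      (P i) (Δ i) (q i)
  costd : ∀ i, IsMaxSubobjectIn (ExtClosure (fun X => ∃ j, j ≤ i ∧ Nonempty (X ≅ S j)))
      (I i) (nabla i) (m i)
  mult_simple : ∀ i j, mult (S i) j = if i = j then 1 else 0
  mult_additive : ∀ T : ShortComplex C, T.ShortExact →
      ∀ j, mult T.X₂ j = mult T.X₁ j + mult T.X₃ j
  mult_eq_zero_iff : ∀ X : C, (∀ j, mult X j = 0) ↔ IsZero X

variable {k : Type v} [Field k] [IsAlgClosed k] [Abelian C] [Linear k C]
  [EnoughProjectives C] {n : ℕ}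

/-- The Serre subcategory `A_i`, i.e. the extension closure of `S 0, …, S i`. -/
def DeligneData.serre (D : DeligneData k C n) (i : Fin n) : C → Prop :=
  ExtClosure (fun X => ∃ j, j ≤ i ∧ Nonempty (X ≅ D.S j))

/-- `A` is a highest-weight category with respect to the given ordering of its simple
objects: `End (Δ i) ≅ k` and each `P i` lies in the extension closure of `Δ i, …, Δ (n-1)`. -/
def DeligneData.IsHighestWeight (D : DeligneData k C n) : Prop :=
  ∀ i, Nonempty (End (D.Δ i) ≃ₐ[k] k) ∧
    ExtClosure (fun X => ∃ j, i ≤ j ∧ Nonempty (X ≅ D.Δ j)) (D.P i)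


section Helpers

set_option linter.unusedSectionVars false

namespace DeligneData

variable (D : DeligneData k C n)

lemma sesMono {X Y : C} (f : X ⟶ Y) [Mono f] :
    (ShortComplex.mk f (cokernel.π f) (cokernel.condition f)).ShortExact where
  exact := ShortComplex.exact_cokernel f

lemma sesEpi {X Y : C} (f : X ⟶ Y) [Epi f] :
    (ShortComplex.mk (kernel.ι f) f (kernel.condition f)).ShortExact where
  exact := ShortComplex.exact_kernel f

lemma mult_zero {X : C} (h : IsZero X) (j : Fin n) : D.mult X j = 0 :=
  (D.mult_eq_zero_iff X).2 h j

lemma mult_mono {X Y : C} (f : X ⟶ Y) [Mono f] (j : Fin n) :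
    D.mult Y j = D.mult X j + D.mult (cokernel f) j :=
  D.mult_additive _ (sesMono f) j

lemma mult_epi {X Y : C} (f : X ⟶ Y) [Epi f] (j : Fin n) :
    D.mult X j = D.mult (kernel f) j + D.mult Y j :=
  D.mult_additive _ (sesEpi f) j

lemma mult_iso {X Y : C} (e : X ≅ Y) (j : Fin n) : D.mult X j = D.mult Y j := by
  have h1 := D.mult_mono e.hom j
  have h2 := D.mult_mono e.inv j
  omega

/-- the length of an object -/
def len (X : C) : ℕ := ∑ j, D.mult X j

lemma len_pos {X : C} (h : ¬ IsZero X) : 0 < D.len X := by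
  by_contra h0
  apply h
  rw [← D.mult_eq_zero_iff]
  intro j
  have : D.len X = 0 := by omega
  unfold len at this
  exact (Finset.sum_eq_zero_iff.1 this) j (Finset.mem_univ j)

lemma len_additive (T : ShortComplex C) (hT : T.ShortExact) :
    D.len T.X₂ = D.len T.X₁ + D.len T.X₃ := by
  unfold len
  rw [← Finset.sum_add_distrib]
  exact Finset.sum_congr rfl fun j _ => D.mult_additive T hT j

lemma dev (Q : C → Prop) (h0 : ∀ X, IsZero X → Q X) (h1 : ∀ X i, (X ≅ D.S i) → Q X)
    (h2 : ∀ T : ShortComplex C, T.ShortExact → Q T.X₁ → Q T.X₃ → Q T.X₂) (X : C) : Q X := by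
  induction hN : D.len X using Nat.strong_induction_on generalizing X with
  | _ N ih =>
    subst hN
    by_cases hz : IsZero X
    · exact h0 X hz
    by_cases hs : Simple X
    · obtain ⟨i, ⟨e⟩⟩ := D.exhaustive X hs
      exact h1 X i e
    have : ∃ (Y : C) (f : Y ⟶ X), Mono f ∧ f ≠ 0 ∧ ¬ IsIso f := by
      by_contra hcon
      push Not at hcon
      refine hs ⟨fun {Y} f hf => ⟨fun hi h => ?_, fun h => hcon Y f hf h⟩⟩
      apply hz
      subst h
      exact (IsZero.iff_id_eq_zero X).2 (isIsoZeroEquiv Y X hi).2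
    obtain ⟨Y, f, hf, hf0, hfi⟩ := this
    have hl := D.len_additive _ (sesMono f)
    dsimp at hl
    have hY : ¬ IsZero Y := fun h => hf0 (h.eq_of_src _ _)
    have hQ : ¬ IsZero (cokernel f) := by
      intro h
      apply hfi
      have : Epi f := Preadditive.epi_of_cokernel_zero (h.eq_of_tgt _ _)
      exact isIso_of_mono_of_epi f
    have a := D.len_pos hY
    have b := D.len_pos hQ
    exact h2 _ (sesMono f) (ih _ (by dsimp; omega) _ rfl) (ih _ (by dsimp; omega) _ rfl)

lemma serre_iff (i : Fin n) (X : C) : D.serre i X ↔ ∀ l, i < l → D.mult X l = 0 := by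
  constructor
  · intro h l hl
    induction h with
    | of X h =>
      obtain ⟨j, hj, ⟨e⟩⟩ := h
      rw [D.mult_iso e, D.mult_simple, if_neg]
      rintro rfl
      exact absurd hl (not_lt.2 hj)
    | zero X h => exact D.mult_zero h l
    | ext T hT _ _ h1 h3 => rw [D.mult_additive T hT, h1, h3]
  · refine D.dev (fun X => (∀ l, i < l → D.mult X l = 0) → D.serre i X) ?_ ?_ ?_ X
    · intro X h _
      exact ExtClosure.zero X h
    · intro X j e h
      refine ExtClosure.of X ⟨j, ?_, ⟨e⟩⟩
      by_contra hj
      have := h j (not_le.1 hj)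
      rw [D.mult_iso e, D.mult_simple, if_pos rfl] at this
      omega
    · intro T hT h1 h3 h
      refine ExtClosure.ext T hT (h1 ?_) (h3 ?_) <;> intro l hl <;>
        have := h l hl <;> rw [D.mult_additive T hT] at this <;> omega

lemma delta_mult {i l : Fin n} (h : i < l) : D.mult (D.Δ i) l = 0 :=
  (D.serre_iff i _).1 (D.std i).2.1 l h

lemma nabla_mult {i l : Fin n} (h : i < l) : D.mult (D.nabla i) l = 0 :=
  (D.serre_iff i _).1 (D.costd i).2.1 l h

/-- every map `P i ⟶ X` with `X` in `A_i` factors through `Δ i`. -/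
lemma factor_delta {i : Fin n} {X : C} (hX : ∀ l, i < l → D.mult X l = 0) (f : D.P i ⟶ X) :
    ∃ g : D.Δ i ⟶ X, D.q i ≫ g = f := by
  obtain ⟨r, hr⟩ := (D.std i).2.2 (Abelian.factorThruImage f) inferInstance
    ((D.serre_iff i _).2 fun l hl => by
      have := D.mult_mono (Abelian.image.ι f) l
      have := hX l hl
      omega)
  exact ⟨r ≫ Abelian.image.ι f, by rw [← Category.assoc, hr, Abelian.image.fac]⟩

lemma factor_nabla {i : Fin n} {X : C} (hX : ∀ l, i < l → D.mult X l = 0) (f : X ⟶ D.I i) :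
    ∃ g : X ⟶ D.nabla i, g ≫ D.m i = f := by
  obtain ⟨r, hr⟩ := (D.costd i).2.2 (Abelian.image.ι f) inferInstance
    ((D.serre_iff i _).2 fun l hl => by
      have := D.mult_epi (Abelian.factorThruImage f) l
      have := hX l hl
      omega)
  exact ⟨Abelian.factorThruImage f ≫ r, by rw [Category.assoc, hr, Abelian.image.fac]⟩

lemma factor_p {i : Fin n} {Y : C} (e : D.P i ⟶ Y) [Epi e] (hY : ¬ IsZero Y) :
    ∃ g : Y ⟶ D.S i, e ≫ g = D.p i := by
  have := D.simple i
  by_cases h : kernel.ι e ≫ D.p i = 0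
  · exact ⟨Abelian.epiDesc e _ h, Abelian.comp_epiDesc e _ h⟩
  · exfalso
    have h1 : Epi (kernel.ι e ≫ D.p i) := epi_of_nonzero_to_simple h
    have h2 : Epi (kernel.ι e) := (D.projCover i).2.2 _ h1
    have h3 : e = 0 := by
      rw [← cancel_epi (kernel.ι e), kernel.condition, comp_zero]
    apply hY
    rw [IsZero.iff_id_eq_zero, ← cancel_epi e, h3]
    simp

lemma factor_ι {i : Fin n} {Y : C} (e : Y ⟶ D.I i) [Mono e] (hY : ¬ IsZero Y) :
    ∃ g : D.S i ⟶ Y, g ≫ e = D.ι i := by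
  have := D.simple i
  by_cases h : D.ι i ≫ cokernel.π e = 0
  · exact ⟨Abelian.monoLift e _ h, Abelian.monoLift_comp e _ h⟩
  · exfalso
    have h1 : Mono (D.ι i ≫ cokernel.π e) := mono_of_nonzero_from_simple h
    have h2 : Mono (cokernel.π e) := (D.injHull i).2.2 _ h1
    have h3 : e = 0 := by
      rw [← cancel_mono (cokernel.π e), cokernel.condition, zero_comp]
    apply hY
    rw [IsZero.iff_id_eq_zero, ← cancel_mono e, h3]
    simp

open Module

lemma p_ne {i : Fin n} : D.p i ≠ 0 := by
  intro h
  have := D.simple i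
  have := (D.projCover i).2.1
  apply Simple.not_isZero (D.S i)
  rw [IsZero.iff_id_eq_zero, ← cancel_epi (D.p i), h]
  simp

lemma ι_ne {i : Fin n} : D.ι i ≠ 0 := by
  intro h
  have := D.simple i
  have := (D.injHull i).2.1
  apply Simple.not_isZero (D.S i)
  rw [IsZero.iff_id_eq_zero, ← cancel_mono (D.ι i), h]
  simp

lemma hom_P_S (i j : Fin n) {f : D.P i ⟶ D.S j} (hf : f ≠ 0) :
    ∃ g : D.S i ⟶ D.S j, IsIso g ∧ D.p i ≫ g = f := by
  have := D.simple i
  have := D.simple j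
  have : Epi f := epi_of_nonzero_to_simple hf
  obtain ⟨g, hg⟩ := D.factor_p f (Simple.not_isZero _)
  have hg0 : g ≠ 0 := by
    rintro rfl
    exact D.p_ne (by rw [← hg, comp_zero])
  have := isIso_of_hom_simple hg0
  exact ⟨inv g, inferInstance, by rw [← hg]; simp⟩

lemma hom_S_I (i j : Fin n) {f : D.S j ⟶ D.I i} (hf : f ≠ 0) :
    ∃ g : D.S j ⟶ D.S i, IsIso g ∧ g ≫ D.ι i = f := by
  have := D.simple i
  have := D.simple j
  have : Mono f := mono_of_nonzero_from_simple hf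
  obtain ⟨g, hg⟩ := D.factor_ι f (Simple.not_isZero _)
  have hg0 : g ≠ 0 := by
    rintro rfl
    exact D.ι_ne (by rw [← hg, zero_comp])
  have := isIso_of_hom_simple hg0
  exact ⟨inv g, inferInstance, by rw [← hg]; simp⟩

lemma finrank_P_S (i j : Fin n) : finrank k (D.P i ⟶ D.S j) = if j = i then 1 else 0 := by
  have := D.simple i
  have := (D.projCover i).2.1
  have := D.homFinite (D.S i) (D.S i)
  split_ifs with h
  · subst h
    rw [← finrank_endomorphism_simple_eq_one k (D.S j)]
    symm
    apply LinearEquiv.finrank_eq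
    refine LinearEquiv.ofBijective (Linear.leftComp k (D.S j) (D.p j)) ⟨?_, ?_⟩
    · intro a b hab
      exact (cancel_epi (D.p j)).1 hab
    · intro f
      by_cases hf : f = 0
      · exact ⟨0, by simp [hf]⟩
      · obtain ⟨g, -, hg⟩ := D.hom_P_S j j hf
        exact ⟨g, hg⟩
  · have : Subsingleton (D.P i ⟶ D.S j) := by
      refine subsingleton_of_forall_eq 0 fun f => ?_
      by_contra hf
      obtain ⟨g, hi, -⟩ := D.hom_P_S i j hf
      exact h (D.distinct _ _ ⟨asIso g⟩).symm
    exact finrank_zero_of_subsingleton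

lemma finrank_S_I (i j : Fin n) : finrank k (D.S j ⟶ D.I i) ≤ if j = i then 1 else 0 := by
  have := D.simple i
  have := D.homFinite (D.S i) (D.S i)
  split_ifs with h
  · subst h
    rw [← finrank_endomorphism_simple_eq_one k (D.S j)]
    refine LinearMap.finrank_le_finrank_of_surjective
      (f := Linear.rightComp k (D.S j) (D.ι j)) ?_
    · intro f
      by_cases hf : f = 0
      · exact ⟨0, by simp [hf]⟩
      · obtain ⟨g, -, hg⟩ := D.hom_S_I j j hf
        exact ⟨g, hg⟩
  · have : Subsingleton (D.S j ⟶ D.I i) := by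
      refine subsingleton_of_forall_eq 0 fun f => ?_
      by_contra hf
      obtain ⟨g, hi, -⟩ := D.hom_S_I i j hf
      exact h (D.distinct _ _ ⟨asIso g⟩)
    exact finrank_zero_of_subsingleton.le

/-- subadditivity of `dim Hom(-, N)` -/
lemma finrank_sub (D : DeligneData k C n) (T : ShortComplex C) (hT : T.ShortExact) (N : C) :
    finrank k (T.X₂ ⟶ N) ≤ finrank k (T.X₁ ⟶ N) + finrank k (T.X₃ ⟶ N) := by
  have := D.homFinite T.X₁ N
  have := D.homFinite T.X₂ N
  have := D.homFinite T.X₃ N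
  have h := LinearMap.finrank_range_add_finrank_ker (Linear.leftComp k N T.f)
  have h1 := Submodule.finrank_le (LinearMap.range (Linear.leftComp k N T.f))
  have h2 : LinearMap.ker (Linear.leftComp k N T.f) ≤
      LinearMap.range (Linear.leftComp k N T.g) := by
    intro f hf
    have := hT.epi_g
    exact ⟨hT.exact.desc f hf, hT.exact.g_desc f hf⟩
  have h3 := Submodule.finrank_mono h2
  have h4 := LinearMap.finrank_range_le (Linear.leftComp k N T.g)
  omega

/-- additivity of `dim Hom(P, -)` -/
lemma finrank_add (D : DeligneData k C n) (T : ShortComplex C) (hT : T.ShortExact) (N : C) [Projective N] :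
    finrank k (N ⟶ T.X₂) = finrank k (N ⟶ T.X₁) + finrank k (N ⟶ T.X₃) := by
  have := D.homFinite N T.X₁
  have := D.homFinite N T.X₂
  have := D.homFinite N T.X₃
  have := hT.epi_g
  have := hT.mono_f
  have h := LinearMap.finrank_range_add_finrank_ker (Linear.rightComp k N T.g)
  have h1 : LinearMap.range (Linear.rightComp k N T.g) = ⊤ := by
    rw [LinearMap.range_eq_top]
    intro f
    exact ⟨Projective.factorThru f T.g, Projective.factorThru_comp f T.g⟩
  have h2 : LinearMap.ker (Linear.rightComp k N T.g) =
      LinearMap.range (Linear.rightComp k N T.f) := by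
    apply le_antisymm
    · intro f hf
      exact ⟨hT.exact.lift f hf, hT.exact.lift_f f hf⟩
    · rintro _ ⟨f, rfl⟩
      simp [LinearMap.mem_ker]
  have h3 : finrank k (LinearMap.range (Linear.rightComp k N T.f)) = finrank k (N ⟶ T.X₁) := by
    apply LinearMap.finrank_range_of_inj
    intro a b hab
    exact (cancel_mono T.f).1 hab
  rw [h1, finrank_top, h2, h3] at h
  omega

lemma finrank_zero_tgt (D : DeligneData k C n) {X N : C} (h : IsZero X) : finrank k (N ⟶ X) = 0 := by
  have : Subsingleton (N ⟶ X) := ⟨fun a b => h.eq_of_tgt a b⟩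
  exact finrank_zero_of_subsingleton

lemma finrank_zero_src (D : DeligneData k C n) {X N : C} (h : IsZero X) : finrank k (X ⟶ N) = 0 := by
  have : Subsingleton (X ⟶ N) := ⟨fun a b => h.eq_of_src a b⟩
  exact finrank_zero_of_subsingleton

lemma finrank_le_epi (D : DeligneData k C n) {X Y N : C} (f : X ⟶ Y) [Epi f] :
    finrank k (Y ⟶ N) ≤ finrank k (X ⟶ N) := by
  have := D.homFinite X N
  refine LinearMap.finrank_le_finrank_of_injective (f := Linear.leftComp k N f) ?_
  intro a b hab
  exact (cancel_epi f).1 hab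

lemma finrank_le_mono (D : DeligneData k C n) {X Y N : C} (f : X ⟶ Y) [Mono f] :
    finrank k (N ⟶ X) ≤ finrank k (N ⟶ Y) := by
  have := D.homFinite N Y
  refine LinearMap.finrank_le_finrank_of_injective (f := Linear.rightComp k N f) ?_
  intro a b hab
  exact (cancel_mono f).1 hab

lemma finrank_P (i : Fin n) (X : C) : finrank k (D.P i ⟶ X) = D.mult X i := by
  have := (D.projCover i).1
  refine D.dev (fun X => finrank k (D.P i ⟶ X) = D.mult X i) ?_ ?_ ?_ X
  · intro X h
    rw [D.mult_zero h, D.finrank_zero_tgt h]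
  · intro X j e
    have h1 := D.finrank_le_mono (N := D.P i) e.hom
    have h2 := D.finrank_le_mono (N := D.P i) e.inv
    rw [D.mult_iso e, D.mult_simple, ← D.finrank_P_S]
    exact le_antisymm h1 h2
  · intro T hT h1 h3
    rw [D.mult_additive T hT, D.finrank_add T hT, h1, h3]

lemma finrank_I (i : Fin n) (X : C) : finrank k (X ⟶ D.I i) ≤ D.mult X i := by
  refine D.dev (fun X => finrank k (X ⟶ D.I i) ≤ D.mult X i) ?_ ?_ ?_ X
  · intro X h
    rw [D.mult_zero h, D.finrank_zero_src h]
  · intro X j e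
    have h2 := D.finrank_le_epi (N := D.I i) e.inv
    rw [D.mult_iso e, D.mult_simple]
    exact h2.trans (D.finrank_S_I i j)
  · intro T hT h1 h3
    have := D.finrank_sub T hT (D.I i)
    rw [D.mult_additive T hT]
    omega

lemma finrank_end (i : Fin n) : finrank k (End (D.Δ i)) = D.mult (D.Δ i) i := by
  rw [← D.finrank_P]
  apply LinearEquiv.finrank_eq
  have := (D.std i).1
  refine LinearEquiv.ofBijective (Linear.leftComp k (D.Δ i) (D.q i)) ⟨?_, ?_⟩
  · intro a b hab
    exact (cancel_epi (D.q i)).1 hab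
  · intro f
    exact D.factor_delta (fun l hl => D.delta_mult hl) f

lemma end_iff (i : Fin n) : Nonempty (End (D.Δ i) ≃ₐ[k] k) ↔ D.mult (D.Δ i) i = 1 := by
  rw [← D.finrank_end]
  constructor
  · rintro ⟨e⟩
    rw [e.toLinearEquiv.finrank_eq, finrank_self]
  · intro h
    have hnt : Nontrivial (End (D.Δ i)) := nontrivial_of_finrank_pos (R := k) (by omega)
    have h1 : Function.Bijective (algebraMap k (End (D.Δ i))) := by
      refine ⟨(algebraMap k (End (D.Δ i))).injective, fun f => ?_⟩
      obtain ⟨c, hc⟩ := (finrank_eq_one_iff_of_nonzero' (1 : End (D.Δ i)) one_ne_zero).1 h f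
      exact ⟨c, by rw [Algebra.algebraMap_eq_smul_one, hc]⟩
    exact ⟨(AlgEquiv.ofBijective (Algebra.ofId k _) h1).symm⟩

/-- `dim Hom(X, ∇ l)` -/
noncomputable def hh (l : Fin n) (X : C) : ℕ := finrank k (X ⟶ D.nabla l)

lemma hh_delta (j l : Fin n) (h1 : D.mult (D.Δ j) j = 1) :
    D.hh l (D.Δ j) ≤ if l = j then 1 else 0 := by
  have hm := (D.costd l).1
  have hq := (D.std j).1
  have a : D.hh l (D.Δ j) ≤ D.mult (D.Δ j) l :=
    (D.finrank_le_mono (D.m l)).trans (D.finrank_I l _)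
  have b : D.hh l (D.Δ j) ≤ D.mult (D.nabla l) j :=
    (D.finrank_le_epi (D.q j)).trans (D.finrank_P j _).le
  split_ifs with h
  · subst h; omega
  · rcases lt_or_gt_of_ne h with h | h
    · rw [D.nabla_mult h] at b; exact b
    · rw [D.delta_mult h] at a; exact a

lemma hh_P (i l : Fin n) : D.hh l (D.P i) = D.mult (D.nabla l) i := D.finrank_P i _

/-- the bound `Σ dim Hom(X, ∇ l) [Δ l : S s]` -/
noncomputable def bd (X : C) (s : Fin n) : ℕ := ∑ l, D.hh l X * D.mult (D.Δ l) s

lemma step {X : C} (hX : ¬ IsZero X) :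
    ∃ (j : Fin n) (Y : C) (r : D.Δ j ⟶ Y) (i : Y ⟶ X), Epi r ∧ Mono i ∧ ¬ IsZero Y ∧
      ∀ l, D.hh l (cokernel i) + (if l = j then 1 else 0) ≤ D.hh l X := by
  have hne : (Finset.univ.filter fun j => D.mult X j ≠ 0).Nonempty := by
    by_contra hcon
    apply hX
    rw [← D.mult_eq_zero_iff]
    intro j
    by_contra hj
    exact hcon ⟨j, by simp [hj]⟩
  obtain ⟨j, hj, hmax⟩ := Finset.exists_max_image _ id hne
  simp only [Finset.mem_filter, Finset.mem_univ, true_and, id] at hj hmax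
  have hXj : ∀ l, j < l → D.mult X l = 0 := by
    intro l hl
    by_contra h
    exact absurd (hmax l h) (not_le.2 hl)
  have : ∃ f : D.P j ⟶ X, f ≠ 0 := by
    by_contra hcon
    push Not at hcon
    have : Subsingleton (D.P j ⟶ X) := subsingleton_of_forall_eq 0 hcon
    apply hj
    rw [← D.finrank_P]
    exact finrank_zero_of_subsingleton
  obtain ⟨f, hf⟩ := this
  let Y := Abelian.image f
  let e : D.P j ⟶ Y := Abelian.factorThruImage f
  let i : Y ⟶ X := Abelian.image.ι f
  have hei : e ≫ i = f := Abelian.image.fac f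
  have hYj : ∀ l, j < l → D.mult Y l = 0 := by
    intro l hl
    have := D.mult_mono i l
    have := hXj l hl
    omega
  have hY : ¬ IsZero Y := by
    intro h
    apply hf
    rw [← hei, h.eq_of_tgt e 0, zero_comp]
  obtain ⟨r, hr⟩ := D.factor_delta hYj e
  have hepi : Epi (D.q j ≫ r) := by rw [hr]; infer_instance
  refine ⟨j, Y, r, i, epi_of_epi (D.q j) r, inferInstance, hY, ?_⟩
  intro l
  split_ifs with h
  · subst h
    obtain ⟨g, hg⟩ := D.factor_p e hY
    have := (D.injHull l).1
    have := (D.injHull l).2.1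
    obtain ⟨t, ht⟩ := D.factor_nabla hXj (Injective.factorThru (g ≫ D.ι l) i)
    have ht0 : i ≫ t ≠ 0 := by
      intro h0
      have h1 : g ≫ D.ι l = 0 := by
        rw [← Injective.comp_factorThru (g ≫ D.ι l) i, ← ht, ← Category.assoc, h0, zero_comp]
      have h2 : g = 0 := by
        rw [← cancel_mono (D.ι l), h1, zero_comp]
      exact D.p_ne (by rw [← hg, h2, comp_zero])
    have := D.homFinite X (D.nabla l)
    have hinj : Function.Injective (Linear.leftComp k (D.nabla l) (cokernel.π i)) := by
      intro a b hab
      exact (cancel_epi (cokernel.π i)).1 hab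
    have hlt : LinearMap.range (Linear.leftComp k (D.nabla l) (cokernel.π i)) < ⊤ := by
      rw [lt_top_iff_ne_top]
      intro htop
      have : t ∈ LinearMap.range (Linear.leftComp k (D.nabla l) (cokernel.π i)) := by
        rw [htop]; trivial
      obtain ⟨a, ha⟩ := this
      apply ht0
      rw [← ha]
      simp
    have := Submodule.finrank_lt_finrank_of_lt hlt
    rw [finrank_top, LinearMap.finrank_range_of_inj hinj] at this
    exact this
  · exact D.finrank_le_epi (cokernel.π i)

lemma bd_step {X Z : C} {j : Fin n}
    (h : ∀ l, D.hh l Z + (if l = j then 1 else 0) ≤ D.hh l X) (s : Fin n) :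
    D.bd Z s + D.mult (D.Δ j) s ≤ D.bd X s := by
  have : D.bd Z s + D.mult (D.Δ j) s =
      ∑ l, (D.hh l Z + (if l = j then 1 else 0)) * D.mult (D.Δ l) s := by
    simp [bd, add_mul, Finset.sum_add_distrib]
  rw [this]
  exact Finset.sum_le_sum fun l _ => Nat.mul_le_mul_right _ (h l)

lemma main_ineq (X : C) : (∀ s, D.mult X s ≤ D.bd X s) ∧
    ∀ Q : Fin n → Prop, (∀ l, D.hh l X ≠ 0 → Q l) → (∀ s, D.mult X s = D.bd X s) →
      ExtClosure (fun X => ∃ j, Q j ∧ Nonempty (X ≅ D.Δ j)) X := by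
  induction hN : D.len X using Nat.strong_induction_on generalizing X with
  | _ N ih =>
    subst hN
    by_cases hz : IsZero X
    · exact ⟨fun s => by rw [D.mult_zero hz]; exact Nat.zero_le _,
        fun Q _ _ => ExtClosure.zero X hz⟩
    obtain ⟨j, Y, r, i, hr, hi, hY, hstep⟩ := D.step hz
    have hl := D.len_additive _ (sesMono i)
    dsimp at hl
    have hlp := D.len_pos hY
    obtain ⟨ih1, ih2⟩ := ih _ (by omega) (cokernel i) rfl
    have hb := D.bd_step hstep
    have hm := D.mult_mono i
    have hd := D.mult_epi r
    refine ⟨fun s => ?_, fun Q hQ heq => ?_⟩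
    · have := ih1 s; have := hb s; have := hm s; have := hd s; omega
    · have hj : Q j := hQ j (by have := hstep j; rw [if_pos rfl] at this; omega)
      refine ExtClosure.ext _ (sesMono i) ?_ ?_
      · refine ExtClosure.of _ ⟨j, hj, ?_⟩
        have hk : IsZero (kernel r) := by
          rw [← D.mult_eq_zero_iff]
          intro s
          have := ih1 s; have := hb s; have := hm s; have := hd s; have := heq s; omega
        have : Mono r := Preadditive.mono_of_kernel_zero (hk.eq_of_src _ _)
        have : IsIso r := isIso_of_mono_of_epi r
        exact ⟨(asIso r).symm⟩
      · refine ih2 Q (fun l hl => hQ l ?_) fun s => ?_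
        · have := hstep l; omega
        · have := ih1 s; have := hb s; have := hm s; have := hd s; have := heq s; omega

lemma bd_of_filtered (h1 : ∀ j, D.mult (D.Δ j) j = 1) (Q : Fin n → Prop) (X : C)
    (hX : ExtClosure (fun X => ∃ j, Q j ∧ Nonempty (X ≅ D.Δ j)) X) (s : Fin n) :
    D.mult X s = D.bd X s := by
  refine le_antisymm ((D.main_ineq X).1 s) ?_
  induction hX with
  | of X h =>
    obtain ⟨j, -, ⟨e⟩⟩ := h
    rw [D.mult_iso e]
    have : D.bd X s ≤ ∑ l, (if l = j then 1 else 0) * D.mult (D.Δ l) s :=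
      Finset.sum_le_sum fun l _ => Nat.mul_le_mul_right _
        ((D.finrank_le_epi e.inv).trans (D.hh_delta j l (h1 j)))
    simpa using this
  | zero X h =>
    have : D.bd X s = 0 := Finset.sum_eq_zero fun l _ => by
      rw [hh, D.finrank_zero_src h, zero_mul]
    omega
  | ext T hT _ _ ha hc =>
    have : D.bd T.X₂ s ≤ D.bd T.X₁ s + D.bd T.X₃ s := by
      unfold bd
      rw [← Finset.sum_add_distrib]
      refine Finset.sum_le_sum fun l _ => ?_
      rw [← add_mul]
      exact Nat.mul_le_mul_right _ (D.finrank_sub T hT _)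
    rw [D.mult_additive T hT]
    omega

end DeligneData

lemma K0.cls_add (T : ShortComplex C) (hT : T.ShortExact) :
    K0.cls T.X₂ = K0.cls T.X₁ + K0.cls T.X₃ := by
  have h : (QuotientAddGroup.mk (FreeAbelianGroup.of T.X₂ - FreeAbelianGroup.of T.X₁ -
      FreeAbelianGroup.of T.X₃) : FreeAbelianGroup C ⧸ K0Relations C) = 0 :=
    (QuotientAddGroup.eq_zero_iff _).2 (AddSubgroup.subset_closure ⟨T, hT, rfl⟩)
  have h' : K0.cls T.X₂ - K0.cls T.X₁ - K0.cls T.X₃ = 0 := h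
  rw [sub_sub, sub_eq_zero] at h'
  exact h'

lemma K0.cls_zero {X : C} (h : IsZero X) : K0.cls X = 0 := by
  have h1 := K0.cls_add (ShortComplex.mk (0 : X ⟶ X) (0 : X ⟶ X) (by simp))
    { exact := ShortComplex.exact_of_isZero_X₂ _ h
      mono_f := ⟨fun a b _ => h.eq_of_tgt a b⟩
      epi_g := ⟨fun a b _ => h.eq_of_src a b⟩ }
  dsimp at h1
  exact left_eq_add.1 h1

lemma K0.cls_iso {X Y : C} (e : X ≅ Y) : K0.cls X = K0.cls Y := by
  have h1 := K0.cls_add _ (DeligneData.sesMono e.hom)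
  have h2 : IsZero (cokernel e.hom) := isZero_cokernel_of_epi e.hom
  dsimp at h1
  rw [h1, K0.cls_zero h2, add_zero]

namespace DeligneData
variable (D : DeligneData k C n)

/-- multiplicity on the Grothendieck group -/
noncomputable def multHom (s : Fin n) : K0 C →+ ℤ :=
  QuotientAddGroup.lift (K0Relations C) (FreeAbelianGroup.lift fun X => (D.mult X s : ℤ)) (by
    unfold K0Relations
    rw [AddSubgroup.closure_le]
    rintro _ ⟨T, hT, rfl⟩
    have := D.mult_additive T hT s
    simp only [SetLike.mem_coe, AddMonoidHom.mem_ker, map_sub, FreeAbelianGroup.lift_apply_of]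
    omega)

lemma multHom_cls (s : Fin n) (X : C) : D.multHom s (K0.cls X) = D.mult X s := by
  change FreeAbelianGroup.lift (fun X => (D.mult X s : ℤ)) (FreeAbelianGroup.of X) = _
  simp

lemma cls_eq (X : C) : K0.cls X = ∑ s, D.mult X s • K0.cls (D.S s) := by
  refine D.dev (fun X => K0.cls X = ∑ s, D.mult X s • K0.cls (D.S s)) ?_ ?_ ?_ X
  · intro X h
    rw [K0.cls_zero h]
    simp [D.mult_zero h]
  · intro X j e
    rw [K0.cls_iso e]
    simp [D.mult_iso e, D.mult_simple]
  · intro T hT h1 h3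
    rw [K0.cls_add T hT, h1, h3]
    simp [D.mult_additive T hT, add_smul, Finset.sum_add_distrib]

end DeligneData

end Helpers

/-- **Theorem 1** (numerical criterion). A Deligne-finite `k`-linear abelian category with a
fixed ordering of its simple objects is highest weight with respect to this ordering if and
only if `[Δ i : S i] = 1` and `[P i] = ∑_{j ≥ i} [∇ j : S i] · [Δ j]` in the Grothendieck
group, for every `i`.  (The sum may equally be taken over all `j`, since `[∇ j : S i] = 0`
for `j < i`.) -/
theorem highestWeight_iff_numerical (D : DeligneData k C n) :
    D.IsHighestWeight ↔
      ∀ i, D.mult (D.Δ i) i = 1 ∧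
        K0.cls (D.P i) =
          ∑ j ∈ Finset.univ.filter (fun j => i ≤ j),
            (D.mult (D.nabla j) i) • K0.cls (D.Δ j) := by
  have key : ∀ i, K0.cls (D.P i) = ∑ j ∈ Finset.univ.filter (fun j => i ≤ j),
      (D.mult (D.nabla j) i) • K0.cls (D.Δ j) ↔ ∀ s, D.mult (D.P i) s = D.bd (D.P i) s := by
    intro i
    have e1 : ∑ j ∈ Finset.univ.filter (fun j => i ≤ j),
        (D.mult (D.nabla j) i) • K0.cls (D.Δ j) = ∑ j, D.hh j (D.P i) • K0.cls (D.Δ j) := by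
      rw [Finset.sum_filter]
      refine Finset.sum_congr rfl fun j _ => ?_
      rw [D.hh_P]
      split_ifs with h
      · rfl
      · rw [D.nabla_mult (not_le.1 h), zero_smul]
    rw [e1]
    constructor
    · intro h s
      have h2 := congrArg (D.multHom s) h
      simp only [map_sum, map_nsmul, D.multHom_cls] at h2
      unfold DeligneData.bd
      have h3 : (D.mult (D.P i) s : ℤ) =
          ((∑ l, D.hh l (D.P i) * D.mult (D.Δ l) s : ℕ) : ℤ) := by
        rw [h2]; push_cast; simp
      exact_mod_cast h3
    · intro h
      rw [D.cls_eq (D.P i)]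
      simp only [h, DeligneData.bd]
      simp_rw [fun j => D.cls_eq (D.Δ j), Finset.sum_smul, Finset.smul_sum, mul_smul]
      rw [Finset.sum_comm]
  constructor
  · intro h
    have h1 : ∀ j, D.mult (D.Δ j) j = 1 := fun j => (D.end_iff j).1 (h j).1
    exact fun i => ⟨h1 i, (key i).2 (D.bd_of_filtered h1 _ _ (h i).2)⟩
  · intro h i
    refine ⟨(D.end_iff i).2 (h i).1,
      (D.main_ineq (D.P i)).2 (fun j => i ≤ j) (fun l hl => ?_) ((key i).1 (h i).2)⟩
    by_contra hc
    rw [D.hh_P] at hl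
    exact hl (D.nabla_mult (not_le.1 hc))

end HWPaper
end

section
/- Let A be a Deligne-finite k-linear abelian category over an algebraically closed field k which is highest weight with respect to a fixed ordering S_1,…,S_n of its simple objects. Then Bernstein–Gelfand–Gelfand reciprocity holds: for all i, j, the multiplicity of the standard object Δ_j in a filtration of the projective cover P_i by standard objects satisfies (P_i : Δ_j) = χ([P_i],[∇_j]) = [∇_j : S_i]. -/
open CategoryTheory CategoryTheory.Limits

universe v u

namespace HWPaper

variable {C : Type u} [Category.{v} C]

variable {k : Type v} [Field k] [IsAlgClosed k] [Abelian C] [Linear k C]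
  [EnoughProjectives C] {n : ℕ}

/-- A filtration of `X` whose subquotients are standard objects: the factor of the `l`-th
step is isomorphic to `Δ (idx l)`. -/
structure StandardFiltration (D : DeligneData k C n) (X : C) where
  /-- the length of the filtration -/
  d : ℕ
  /-- the filtration steps -/
  F : Fin (d + 1) → C
  isZero_bot : IsZero (F 0)
  top_iso : Nonempty (F (Fin.last d) ≅ X)
  /-- the inclusion maps -/
  f : ∀ l : Fin d, F l.castSucc ⟶ F l.succ
  mono : ∀ l, Mono (f l)
  /-- which standard object occurs as the `l`-th factor -/
  idx : Fin d → Fin n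
  factor_iso : ∀ l, Nonempty (cokernel (f l) ≅ D.Δ (idx l))

set_option linter.unusedSectionVars false

/-! ### Additive functions -/

/-- additivity on short exact sequences -/
def IsAdd (φ : C → ℕ) : Prop :=
  ∀ T : ShortComplex C, T.ShortExact → φ T.X₂ = φ T.X₁ + φ T.X₃

lemma shortExact_of_iso_zero {X Y Z : C} (e : X ≅ Y) (hZ : IsZero Z) :
    (ShortComplex.mk e.hom (0 : Y ⟶ Z) (by simp)).ShortExact := by
  have : Epi (0 : Y ⟶ Z) := ⟨fun _ _ _ => hZ.eq_of_src _ _⟩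
  refine ShortComplex.ShortExact.mk' ?_ (by dsimp; infer_instance) this
  exact (ShortComplex.exact_iff_epi _ rfl).2 (by dsimp; infer_instance)

lemma IsAdd.zero {φ : C → ℕ} (h : IsAdd φ) {Z : C} (hZ : IsZero Z) : φ Z = 0 := by
  have := h _ (shortExact_of_iso_zero (Iso.refl Z) hZ)
  dsimp at this
  omega

lemma IsAdd.iso {φ : C → ℕ} (h : IsAdd φ) {X Y : C} (e : X ≅ Y) : φ X = φ Y := by
  have h1 := h _ (shortExact_of_iso_zero e (isZero_zero C))
  have h2 := h.zero (isZero_zero C)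
  dsimp at h1 
  omega

lemma shortExact_mono {X Y : C} (f : X ⟶ Y) [Mono f] :
    (ShortComplex.mk f (cokernel.π f) (by simp)).ShortExact :=
  ShortComplex.ShortExact.mk' (ShortComplex.exact_cokernel f)
    (by dsimp; infer_instance) (by dsimp; infer_instance)

lemma shortExact_epi {X Y : C} (f : X ⟶ Y) [Epi f] :
    (ShortComplex.mk (kernel.ι f) f (by simp)).ShortExact :=
  ShortComplex.ShortExact.mk' (ShortComplex.exact_kernel f)
    (by dsimp; infer_instance) (by dsimp; infer_instance)

lemma IsAdd.le_mono {φ : C → ℕ} (h : IsAdd φ) {X Y : C} (f : X ⟶ Y) [Mono f] : φ X ≤ φ Y := by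
  have := h _ (shortExact_mono f)
  dsimp at this; omega

lemma IsAdd.le_epi {φ : C → ℕ} (h : IsAdd φ) {X Y : C} (f : X ⟶ Y) [Epi f] : φ Y ≤ φ X := by
  have := h _ (shortExact_epi f)
  dsimp at this; omega

lemma IsAdd.eq_of_extClosure {Q : C → Prop} {φ ψ : C → ℕ} (hφ : IsAdd φ) (hψ : IsAdd ψ)
    (h : ∀ X, Q X → φ X = ψ X) {X : C} (hX : ExtClosure Q X) : φ X = ψ X := by
  induction hX with
  | of X hX => exact h X hX
  | zero X hX => rw [hφ.zero hX, hψ.zero hX]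
  | ext S hS _ _ h1 h3 => rw [hφ _ hS, hψ _ hS, h1, h3]

lemma DeligneData.isAdd_mult (D : DeligneData k C n) (j : Fin n) : IsAdd (fun X => D.mult X j) :=
  fun T hT => D.mult_additive T hT j

lemma isAdd_sum (φ : Fin n → C → ℕ) (h : ∀ j, IsAdd (φ j)) : IsAdd (fun X => ∑ j, φ j X) := by
  intro T hT
  dsimp only
  rw [← Finset.sum_add_distrib]
  exact Finset.sum_congr rfl fun j _ => h j T hT

lemma DeligneData.total_pos (D : DeligneData k C n) {X : C} (hX : ¬ IsZero X) :
    0 < ∑ j, D.mult X j := by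
  rw [Nat.pos_iff_ne_zero]
  intro h
  apply hX
  rw [← D.mult_eq_zero_iff]
  intro j
  exact (Finset.sum_eq_zero_iff.1 h) j (Finset.mem_univ j)

/-- Every object with multiplicities supported in `Q` lies in the extension closure. -/
lemma DeligneData.mem_of_support (D : DeligneData k C n) (Q : Fin n → Prop) (N : ℕ) :
    ∀ X : C, ∑ j, D.mult X j ≤ N → (∀ j, ¬ Q j → D.mult X j = 0) →
      ExtClosure (fun X => ∃ j, Q j ∧ Nonempty (X ≅ D.S j)) X := by
  induction N with
  | zero =>
    intro X hX _
    by_cases h0 : IsZero X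
    · exact .zero _ h0
    · have := D.total_pos h0; omega
  | succ N ih =>
    intro X hX hQ
    by_cases h0 : IsZero X
    · exact .zero _ h0
    by_cases hs : Simple X
    · obtain ⟨i, ⟨e⟩⟩ := D.exhaustive X hs
      refine .of _ ⟨i, ?_, ⟨e⟩⟩
      by_contra hi
      have h1 := hQ i hi
      have h2 := (D.isAdd_mult i).iso e
      have h3 := D.mult_simple i i
      simp at h3
      omega
    · have : ∃ (Y : C) (f : Y ⟶ X), Mono f ∧ ¬ (IsIso f ↔ f ≠ 0) := by
        by_contra hcon
        push Not at hcon
        exact hs ⟨fun {Y} f hf => hcon Y f hf⟩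
      obtain ⟨Y, f, hf, hne⟩ := this
      have hni : ¬ IsIso f ∧ f ≠ 0 := by
        by_cases hi : IsIso f
        · exfalso
          apply hne
          refine ⟨fun _ h => h0 ?_, fun _ => hi⟩
          rw [IsZero.iff_id_eq_zero, ← IsIso.inv_hom_id f]
          exact (congrArg (fun x => inv f ≫ x) h).trans comp_zero
        · refine ⟨hi, fun h => hne ⟨fun h' => absurd h' hi, fun h' => absurd h h'⟩⟩
      have hse := shortExact_mono f
      have hY : ¬ IsZero Y := fun h => hni.2 (h.eq_of_src _ _)
      have hK : ¬ IsZero (cokernel f) := fun h => by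
        have : Epi f := Preadditive.epi_of_isZero_cokernel f h
        exact hni.1 (isIso_of_mono_of_epi f)
      have hY' := D.total_pos hY
      have hK' := D.total_pos hK
      have hadd := isAdd_sum _ D.isAdd_mult _ hse
      dsimp at hadd
      refine .ext _ hse (ih _ ?_ ?_) (ih _ ?_ ?_)
      · dsimp; omega
      · intro j hj
        have := D.mult_additive _ hse j
        have := hQ j hj
        dsimp at *; omega
      · dsimp; omega
      · intro j hj
        have := D.mult_additive _ hse j
        have := hQ j hj
        dsimp at *; omega

lemma DeligneData.mem_serre_iff (D : DeligneData k C n) (i : Fin n) (X : C) :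
    ExtClosure (fun X => ∃ j, j ≤ i ∧ Nonempty (X ≅ D.S j)) X ↔
      ∀ j, i < j → D.mult X j = 0 := by
  constructor
  · intro h j hj
    refine IsAdd.eq_of_extClosure (ψ := fun _ => 0) (D.isAdd_mult j) (fun _ _ => rfl) ?_ h
    rintro X ⟨l, hl, ⟨e⟩⟩
    rw [(D.isAdd_mult j).iso e, D.mult_simple, if_neg]
    rintro rfl
    exact absurd hj (not_lt.2 hl)
  · intro h
    exact D.mem_of_support (fun j => j ≤ i) _ X le_rfl fun j hj => h j (not_le.1 hj)

lemma DeligneData.eq_of_simple (D : DeligneData k C n) {φ ψ : C → ℕ} (hφ : IsAdd φ) (hψ : IsAdd ψ)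
    (h : ∀ j, φ (D.S j) = ψ (D.S j)) (X : C) : φ X = ψ X := by
  refine hφ.eq_of_extClosure hψ ?_
    (D.mem_of_support (fun _ => True) _ X le_rfl fun j hj => absurd trivial hj)
  rintro X ⟨j, -, ⟨e⟩⟩
  rw [hφ.iso e, hψ.iso e, h]

/-! ### Hom dimensions -/

lemma finrank_exact {V W U : Type*} [AddCommGroup V] [Module k V] [AddCommGroup W] [Module k W]
    [AddCommGroup U] [Module k U] [FiniteDimensional k W] (f : V →ₗ[k] W) (g : W →ₗ[k] U)
    (hf : Function.Injective f) (hg : Function.Surjective g)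
    (h0 : ∀ x, g (f x) = 0) (h1 : ∀ y, g y = 0 → ∃ x, f x = y) :
    Module.finrank k W = Module.finrank k V + Module.finrank k U := by
  have h := g.finrank_range_add_finrank_ker
  rw [LinearMap.range_eq_top.2 hg, finrank_top] at h
  have : LinearMap.ker g = LinearMap.range f := by
    ext y
    simp only [LinearMap.mem_ker, LinearMap.mem_range]
    exact ⟨h1 y, by rintro ⟨x, rfl⟩; exact h0 x⟩
  rw [this, LinearMap.finrank_range_of_inj hf] at h
  omega

lemma finrank_hom_left (T : ShortComplex C) (hT : T.ShortExact) (Y : C)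
    [FiniteDimensional k (Y ⟶ T.X₂)] (hY : ∀ f : Y ⟶ T.X₃, ∃ g : Y ⟶ T.X₂, g ≫ T.g = f) :
    Module.finrank k (Y ⟶ T.X₂) = Module.finrank k (Y ⟶ T.X₁) + Module.finrank k (Y ⟶ T.X₃) := by
  have := hT.mono_f
  refine finrank_exact (Linear.rightComp k Y T.f) (Linear.rightComp k Y T.g) ?_ ?_ ?_ ?_
  · intro a b hab
    exact (cancel_mono T.f).1 hab
  · exact hY
  · intro x; simp
  · intro y hy
    exact ⟨hT.exact.lift y hy, hT.exact.lift_f y hy⟩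

lemma finrank_hom_right (T : ShortComplex C) (hT : T.ShortExact) (Y : C)
    [FiniteDimensional k (T.X₂ ⟶ Y)] (hY : ∀ f : T.X₁ ⟶ Y, ∃ g : T.X₂ ⟶ Y, T.f ≫ g = f) :
    Module.finrank k (T.X₂ ⟶ Y) = Module.finrank k (T.X₁ ⟶ Y) + Module.finrank k (T.X₃ ⟶ Y) := by
  have := hT.epi_g
  rw [add_comm]
  refine finrank_exact (Linear.leftComp k Y T.g) (Linear.leftComp k Y T.f) ?_ ?_ ?_ ?_
  · intro a b hab
    exact (cancel_epi T.g).1 hab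
  · exact hY
  · intro x; simp
  · intro y hy
    exact ⟨hT.exact.desc y hy, hT.exact.g_desc y hy⟩

/-- precomposition bijective gives equality of dimensions -/
lemma finrank_precomp {X Y Z : C} (q : X ⟶ Y) [Epi q]
    (h : ∀ f : X ⟶ Z, ∃ g : Y ⟶ Z, q ≫ g = f) :
    Module.finrank k (Y ⟶ Z) = Module.finrank k (X ⟶ Z) :=
  (LinearEquiv.ofBijective (Linear.leftComp k Z q)
    ⟨fun _ _ hab => (cancel_epi q).1 hab, h⟩).finrank_eq

lemma finrank_postcomp {X Y Z : C} (m : Y ⟶ Z) [Mono m]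
    (h : ∀ f : X ⟶ Z, ∃ g : X ⟶ Y, g ≫ m = f) :
    Module.finrank k (X ⟶ Y) = Module.finrank k (X ⟶ Z) :=
  (LinearEquiv.ofBijective (Linear.rightComp k X m)
    ⟨fun _ _ hab => (cancel_mono m).1 hab, h⟩).finrank_eq

lemma finrank_hom_zero_of_forall {X Y : C} (h : ∀ f : X ⟶ Y, f = 0) :
    Module.finrank k (X ⟶ Y) = 0 :=
  haveI : Subsingleton (X ⟶ Y) := ⟨fun a b => by rw [h a, h b]⟩
  Module.finrank_zero_of_subsingleton

lemma DeligneData.finrank_P_s6 (D : DeligneData k C n) (i : Fin n) (X : C) :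
    Module.finrank k (D.P i ⟶ X) = D.mult X i := by
  have hfin := D.homFinite
  obtain ⟨hP, hp, hsup⟩ := D.projCover i
  refine D.eq_of_simple (φ := fun X => Module.finrank k (D.P i ⟶ X))
    (ψ := fun X => D.mult X i) ?_ (D.isAdd_mult i) ?_ X
  · intro T hT
    have := hT.epi_g
    exact finrank_hom_left T hT _ fun f => ⟨Projective.factorThru f T.g, by simp⟩
  · intro j
    have := D.simple
    have key : ∀ f : D.P i ⟶ D.S j, f ≠ 0 → ∃ e : D.S j ≅ D.S i, f ≫ e.hom = D.p i := by
      intro f hf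
      have : Epi f := epi_of_nonzero_to_simple hf
      have h0 : kernel.ι f ≫ D.p i = 0 := by
        by_contra hne
        have := hsup (kernel.ι f) (epi_of_nonzero_to_simple hne)
        apply hf
        rw [← cancel_epi (kernel.ι f)]
        simp
      have hse := shortExact_epi f
      obtain ⟨g, hg⟩ : ∃ g : D.S j ⟶ D.S i, f ≫ g = D.p i :=
        ⟨hse.exact.desc (D.p i) h0, hse.exact.g_desc (D.p i) h0⟩
      have hg0 : g ≠ 0 := by
        rintro rfl
        rw [comp_zero] at hg
        rw [← hg] at hp
        apply id_nonzero (D.S i)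
        rw [← cancel_epi (0 : D.P i ⟶ D.S i)]
        simp
      have := isIso_of_hom_simple hg0
      exact ⟨asIso g, hg⟩
    rw [D.mult_simple]
    split_ifs with h
    · subst h
      rw [← finrank_precomp (D.p j), finrank_endomorphism_simple_eq_one]
      intro f
      by_cases hf : f = 0
      · exact ⟨0, by simp [hf]⟩
      · obtain ⟨e, he⟩ := key f hf
        exact ⟨e.inv, by rw [← he]; simp⟩
    · apply finrank_hom_zero_of_forall
      intro f
      by_contra hf
      obtain ⟨e, -⟩ := key f hf
      exact h (D.distinct _ _ ⟨e⟩)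

lemma DeligneData.finrank_I_s6 (D : DeligneData k C n) (i : Fin n) (X : C) :
    Module.finrank k (X ⟶ D.I i) = D.mult X i := by
  have hfin := D.homFinite
  obtain ⟨hP, hp, hsup⟩ := D.injHull i
  refine D.eq_of_simple (φ := fun X => Module.finrank k (X ⟶ D.I i))
    (ψ := fun X => D.mult X i) ?_ (D.isAdd_mult i) ?_ X
  · intro T hT
    have := hT.mono_f
    exact finrank_hom_right T hT _ fun f => ⟨Injective.factorThru f T.f, by simp⟩
  · intro j
    have := D.simple
    have key : ∀ f : D.S j ⟶ D.I i, f ≠ 0 → ∃ e : D.S i ≅ D.S j, e.hom ≫ f = D.ι i := by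
      intro f hf
      have : Mono f := mono_of_nonzero_from_simple hf
      have h0 : D.ι i ≫ cokernel.π f = 0 := by
        by_contra hne
        have := hsup (cokernel.π f) (mono_of_nonzero_from_simple hne)
        apply hf
        rw [← cancel_mono (cokernel.π f)]
        simp
      have hse := shortExact_mono f
      obtain ⟨g, hg⟩ : ∃ g : D.S i ⟶ D.S j, g ≫ f = D.ι i :=
        ⟨hse.exact.lift (D.ι i) h0, hse.exact.lift_f (D.ι i) h0⟩
      have hg0 : g ≠ 0 := by
        rintro rfl
        rw [zero_comp] at hg
        rw [← hg] at hp
        apply id_nonzero (D.S i)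
        rw [← cancel_mono (0 : D.S i ⟶ D.I i)]
        simp
      have := isIso_of_hom_simple hg0
      exact ⟨asIso g, hg⟩
    rw [D.mult_simple]
    split_ifs with h
    · subst h
      rw [← finrank_postcomp (D.ι j), finrank_endomorphism_simple_eq_one]
      intro f
      by_cases hf : f = 0
      · exact ⟨0, by simp [hf]⟩
      · obtain ⟨e, he⟩ := key f hf
        exact ⟨e.inv, by rw [← he]; simp⟩
    · apply finrank_hom_zero_of_forall
      intro f
      by_contra hf
      obtain ⟨e, -⟩ := key f hf
      exact h (D.distinct _ _ ⟨e⟩).symm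

/-! ### Standard and costandard objects -/

lemma DeligneData.mult_Δ (D : DeligneData k C n) (i j : Fin n) (h : i < j) :
    D.mult (D.Δ i) j = 0 :=
  (D.mem_serre_iff i _).1 (D.std i).2.1 j h

lemma DeligneData.mult_nabla (D : DeligneData k C n) (i j : Fin n) (h : i < j) :
    D.mult (D.nabla i) j = 0 :=
  (D.mem_serre_iff i _).1 (D.costd i).2.1 j h

lemma DeligneData.factor_q (D : DeligneData k C n) (i : Fin n) {E : C}
    (hE : ∀ j, i < j → D.mult E j = 0) (t : D.P i ⟶ E) : ∃ r : D.Δ i ⟶ E, D.q i ≫ r = t := by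
  obtain ⟨r, hr⟩ := (D.std i).2.2 (factorThruImage t) inferInstance
    ((D.mem_serre_iff i _).2 fun j hj => by
      have := (D.isAdd_mult j).le_mono (image.ι t)
      have := hE j hj
      omega)
  exact ⟨r ≫ image.ι t, by rw [← Category.assoc, hr, image.fac]⟩

lemma DeligneData.factor_m (D : DeligneData k C n) (i : Fin n) {E : C}
    (hE : ∀ j, i < j → D.mult E j = 0) (t : E ⟶ D.I i) : ∃ r : E ⟶ D.nabla i, r ≫ D.m i = t := by
  obtain ⟨r, hr⟩ := (D.costd i).2.2 (image.ι t) inferInstance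
    ((D.mem_serre_iff i _).2 fun j hj => by
      have := (D.isAdd_mult j).le_epi (factorThruImage t)
      have := hE j hj
      omega)
  exact ⟨factorThruImage t ≫ r, by rw [Category.assoc, hr, image.fac]⟩

lemma DeligneData.finrank_Δ_nabla (D : DeligneData k C n) (hhw : D.IsHighestWeight) (l j : Fin n) :
    Module.finrank k (D.Δ l ⟶ D.nabla j) = if l = j then 1 else 0 := by
  have hfin := D.homFinite
  have hq := (D.std l).1
  have hm := (D.costd j).1
  rcases lt_trichotomy l j with h | rfl | h
  · rw [if_neg h.ne]
    apply finrank_hom_zero_of_forall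
    intro f
    have h0 : Module.finrank k (D.Δ l ⟶ D.I j) = 0 := by rw [D.finrank_I_s6, D.mult_Δ _ _ h]
    have := Module.finrank_zero_iff.1 h0
    rw [← cancel_mono (D.m j)]
    exact Subsingleton.elim _ _
  · rw [if_pos rfl, finrank_postcomp (D.m l) (D.factor_m l (D.mult_Δ l)), D.finrank_I_s6,
      ← D.finrank_P_s6, ← finrank_precomp (D.q l) (D.factor_q l (D.mult_Δ l))]
    obtain ⟨e⟩ := (hhw l).1
    rw [← Module.finrank_self k]
    exact e.toLinearEquiv.finrank_eq
  · rw [if_neg h.ne']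
    apply finrank_hom_zero_of_forall
    intro f
    have h0 : Module.finrank k (D.P l ⟶ D.nabla j) = 0 := by rw [D.finrank_P_s6, D.mult_nabla _ _ h]
    have := Module.finrank_zero_iff.1 h0
    rw [← cancel_epi (D.q l)]
    exact Subsingleton.elim _ _

/-- `Ext¹(Δ l, ∇ j) = 0` : every extension splits. -/
lemma DeligneData.split (D : DeligneData k C n) (l j : Fin n) (T : ShortComplex C)
    (hT : T.ShortExact) (e₁ : T.X₁ ≅ D.nabla j) (e₃ : T.X₃ ≅ D.Δ l) :
    ∃ r : T.X₂ ⟶ T.X₁, T.f ≫ r = 𝟙 _ := by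
  have := hT.mono_f
  have := hT.epi_g
  have hm1 : ∀ x, D.mult T.X₁ x = D.mult (D.nabla j) x := fun x => (D.isAdd_mult x).iso e₁
  have hm3 : ∀ x, D.mult T.X₃ x = D.mult (D.Δ l) x := fun x => (D.isAdd_mult x).iso e₃
  have hm : ∀ x, l < x → j < x → D.mult T.X₂ x = 0 := fun x hx hx' => by
    rw [D.mult_additive T hT, hm1, hm3, D.mult_nabla _ _ hx', D.mult_Δ _ _ hx]
  rcases le_total j l with h | h
  · have := (D.projCover l).1
    have hq := (D.std l).1
    obtain ⟨s, hs⟩ := D.factor_q l (fun x hx => hm x hx (h.trans_lt hx))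
      (Projective.factorThru (D.q l ≫ e₃.inv) T.g)
    have hs' : (e₃.hom ≫ s) ≫ T.g = 𝟙 _ := by
      rw [← cancel_epi e₃.inv, ← cancel_epi (D.q l)]
      simp only [Category.assoc, Iso.inv_hom_id_assoc, Category.comp_id]
      rw [← Category.assoc, hs, Projective.factorThru_comp]
    let sp := ShortComplex.Splitting.ofExactOfSection T hT.exact (e₃.hom ≫ s) hs' inferInstance
    exact ⟨sp.r, sp.f_r⟩
  · have := (D.injHull j).1
    have hm' := (D.costd j).1
    obtain ⟨s, hs⟩ := D.factor_m j (fun x hx => hm x (h.trans_lt hx) hx)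
      (Injective.factorThru (e₁.hom ≫ D.m j) T.f)
    refine ⟨s ≫ e₁.inv, ?_⟩
    rw [← cancel_mono e₁.hom, ← cancel_mono (D.m j)]
    simp only [Category.assoc, Iso.inv_hom_id_assoc, Category.id_comp]
    rw [hs, Injective.comp_factorThru]

lemma DeligneData.extend (D : DeligneData k C n) (l j : Fin n) (T : ShortComplex C)
    (hT : T.ShortExact) (e₃ : T.X₃ ≅ D.Δ l) (h : T.X₁ ⟶ D.nabla j) :
    ∃ g : T.X₂ ⟶ D.nabla j, T.f ≫ g = h := by
  have := hT.mono_f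
  have := hT.epi_g
  let π : pushout T.f h ⟶ T.X₃ := pushout.desc T.g 0 (by simp)
  have hπ : pushout.inl T.f h ≫ π = T.g := pushout.inl_desc _ _ _
  have hπ0 : pushout.inr T.f h ≫ π = 0 := pushout.inr_desc _ _ _
  have hepi : Epi π := by
    rw [← hπ] at this
    exact epi_of_epi (pushout.inl T.f h) π
  let E : ShortComplex C := ShortComplex.mk (pushout.inr T.f h) π hπ0
  have hE : E.ShortExact := by
    refine ShortComplex.ShortExact.mk' ?_ (by dsimp [E]; infer_instance) hepi
    refine E.exact_of_g_is_cokernel (CokernelCofork.IsColimit.ofπ' _ hπ0 fun {A} φ hφ => ?_)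
    have h0 : T.f ≫ pushout.inl T.f h ≫ φ = 0 := by
      rw [pushout.condition_assoc]
      have hφ' : pushout.inr T.f h ≫ φ = 0 := hφ
      rw [hφ', comp_zero]
    refine ⟨hT.exact.desc _ h0, ?_⟩
    apply pushout.hom_ext
    · rw [← Category.assoc]
      erw [hπ]
      exact hT.exact.g_desc _ h0
    · rw [← Category.assoc]
      erw [hπ0, hφ, zero_comp]
  obtain ⟨r, hr⟩ := D.split l j E hE (Iso.refl _) e₃
  have hr' : pushout.inr T.f h ≫ r = 𝟙 _ := hr
  refine ⟨pushout.inl T.f h ≫ r, ?_⟩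
  rw [pushout.condition_assoc, hr', Category.comp_id]

lemma fin_count (d : ℕ) : ∀ (g : Fin (d + 1) → ℕ) (a : Fin d → ℕ), g 0 = 0 →
    (∀ l : Fin d, g l.succ = g l.castSucc + a l) → g (Fin.last d) = ∑ l, a l := by
  induction d with
  | zero => intro g a h0 _; simpa using h0
  | succ d ih =>
    intro g a h0 h
    rw [Fin.sum_univ_castSucc, ← ih (fun x => g x.castSucc) (fun x => a x.castSucc) h0
      (fun l => h l.castSucc)]
    exact h (Fin.last d)

lemma DeligneData.card_eq (D : DeligneData k C n) (hhw : D.IsHighestWeight) (X : C)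
    (filt : StandardFiltration D X) (j : Fin n) :
    (Finset.univ.filter (fun l => filt.idx l = j)).card = Module.finrank k (X ⟶ D.nabla j) := by
  have hfin := D.homFinite
  have iso : ∀ {A B : C}, (A ≅ B) →
      Module.finrank k (A ⟶ D.nabla j) = Module.finrank k (B ⟶ D.nabla j) := fun {A B} e =>
    (finrank_precomp e.hom fun f => ⟨e.inv ≫ f, by simp⟩).symm
  obtain ⟨e⟩ := filt.top_iso
  rw [← iso e, Finset.card_filter]
  symm
  apply fin_count filt.d (fun l => Module.finrank k (filt.F l ⟶ D.nabla j))
  · exact finrank_hom_zero_of_forall fun f => filt.isZero_bot.eq_of_src _ _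
  · intro l
    have := filt.mono l
    obtain ⟨e'⟩ := filt.factor_iso l
    have := finrank_hom_right (k := k) _ (shortExact_mono (filt.f l)) (D.nabla j)
      (D.extend _ j _ (shortExact_mono (filt.f l)) e')
    dsimp at this ⊢
    rw [this, iso e', D.finrank_Δ_nabla hhw]

/-! ### Existence of filtrations -/

/-- iterated extensions by standard objects at the top -/
inductive Filt (D : DeligneData k C n) : C → Prop
  | zero (X : C) : IsZero X → Filt D X
  | step (T : ShortComplex C) (hT : T.ShortExact) (j : Fin n) (e : T.X₃ ≅ D.Δ j) :
      Filt D T.X₁ → Filt D T.X₂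

lemma shortExact_comp_iso {T : ShortComplex C} (hT : T.ShortExact) {Y : C} (e : T.X₂ ≅ Y) :
    (ShortComplex.mk (T.f ≫ e.hom) (e.inv ≫ T.g) (by simp)).ShortExact := by
  refine ShortComplex.shortExact_of_iso (S₁ := T) ?_ hT
  exact ShortComplex.isoMk (Iso.refl _) e (Iso.refl _) (by simp) (by simp)

lemma Filt.iso {D : DeligneData k C n} {X Y : C} (h : Filt D X) (e : X ≅ Y) : Filt D Y := by
  cases h with
  | zero _ h => exact .zero _ (h.of_iso e.symm)
  | step T hT j e' h => exact Filt.step _ (shortExact_comp_iso hT e) j e' h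

lemma Filt.ext {D : DeligneData k C n} {X₁ X₃ : C} (h₁ : Filt D X₁) (h₃ : Filt D X₃) :
    ∀ (X₂ : C) (f : X₁ ⟶ X₂) (g : X₂ ⟶ X₃) (w : f ≫ g = 0),
      (ShortComplex.mk f g w).ShortExact → Filt D X₂ := by
  induction h₃ with
  | zero X₃ h =>
    intro X₂ f g w hS
    have := hS.mono_f
    have : Epi f := hS.exact.epi_f (h.eq_of_tgt _ _)
    have : Mono f := hS.mono_f
    have := isIso_of_mono_of_epi f
    exact h₁.iso (asIso f)
  | step T hT j e _ ih =>
    intro X₂ f g w hS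
    have : Mono f := hS.mono_f
    have : Epi g := hS.epi_g
    have := hT.mono_f
    have := hT.epi_g
    have hsnd : pullback.lift f 0 (by simp [w]) ≫ pullback.snd g T.f = 0 :=
      pullback.lift_snd _ _ _
    have hfst : pullback.lift f 0 (by simp [w]) ≫ pullback.fst g T.f = f :=
      pullback.lift_fst _ _ _
    have hmono : Mono (pullback.lift f 0 (by simp [w]) : X₁ ⟶ pullback g T.f) := by
      have h : Mono f := inferInstance
      rw [← hfst] at h
      exact mono_of_mono _ (pullback.fst g T.f)
    have hF : Filt D (pullback g T.f) := by
      refine ih _ (pullback.lift f 0 (by simp [w])) (pullback.snd g T.f) hsnd ?_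
      refine ShortComplex.ShortExact.mk' ?_ hmono (by dsimp; infer_instance)
      refine ShortComplex.exact_of_f_is_kernel _
        (KernelFork.IsLimit.ofι' _ hsnd fun {A} φ hφ => ?_)
      have hφ' : φ ≫ pullback.snd g T.f = 0 := hφ
      have h0 : (φ ≫ pullback.fst g T.f) ≫ g = 0 := by
        rw [Category.assoc, pullback.condition, ← Category.assoc, hφ', zero_comp]
      refine ⟨hS.exact.lift _ h0, ?_⟩
      apply pullback.hom_ext
      · rw [Category.assoc]
        erw [hfst]
        exact hS.exact.lift_f _ h0
      · rw [Category.assoc]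
        erw [hsnd, hφ, comp_zero]
    have w' : pullback.fst g T.f ≫ g ≫ T.g = 0 := by
      rw [pullback.condition_assoc, T.zero, comp_zero]
    refine Filt.step (ShortComplex.mk (pullback.fst g T.f) (g ≫ T.g) w') ?_ j e hF
    refine ShortComplex.ShortExact.mk' ?_ (by dsimp; infer_instance) (by dsimp; infer_instance)
    refine ShortComplex.exact_of_f_is_kernel _
        (KernelFork.IsLimit.ofι' _ w' fun {A} φ hφ => ?_)
    have h0 : (φ ≫ g) ≫ T.g = 0 := by rw [Category.assoc]; exact hφ
    exact ⟨pullback.lift φ (hT.exact.lift _ h0) (hT.exact.lift_f _ h0).symm,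
      pullback.lift_fst _ _ _⟩

/-- `A` embeds in `B` with standard quotient -/
def StdStep (D : DeligneData k C n) (A B : C) : Prop :=
  ∃ f : A ⟶ B, Mono f ∧ ∃ j, Nonempty (cokernel f ≅ D.Δ j)

lemma Filt.exists_chain {D : DeligneData k C n} {X : C} (h : Filt D X) :
    ∃ (d : ℕ) (F : Fin (d + 1) → C), IsZero (F 0) ∧ F (Fin.last d) = X ∧
      ∀ l : Fin d, StdStep D (F l.castSucc) (F l.succ) := by
  induction h with
  | zero X h => exact ⟨0, fun _ => X, h, rfl, fun l => l.elim0⟩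
  | step T hT j e _ ih =>
    obtain ⟨d, F, h0, hl, hs⟩ := ih
    refine ⟨d + 1, Fin.snoc (α := fun _ => C) F T.X₂, ?_, by simp, ?_⟩
    · rw [← Fin.castSucc_zero, Fin.snoc_castSucc]
      exact h0
    · intro l
      induction l using Fin.lastCases with
      | last =>
        rw [Fin.snoc_castSucc, Fin.succ_last, Fin.snoc_last, hl]
        have := hT.mono_f
        have := hT.epi_g
        exact ⟨T.f, hT.mono_f, j,
          ⟨(cokernelIsCokernel T.f).coconePointUniqueUpToIso hT.gIsCokernel ≪≫ e⟩⟩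
      | cast l =>
        rw [Fin.snoc_castSucc, Fin.succ_castSucc, Fin.snoc_castSucc]
        exact hs l

lemma Filt.nonempty {D : DeligneData k C n} {X : C} (h : Filt D X) :
    Nonempty (StandardFiltration D X) := by
  obtain ⟨d, F, h0, hl, hs⟩ := h.exists_chain
  choose f hf idx hidx using hs
  exact ⟨⟨d, F, h0, ⟨eqToIso hl⟩, f, hf, idx, hidx⟩⟩

open ZeroObject in
lemma Filt.of_extClosure {D : DeligneData k C n} {Q : C → Prop} {X : C} (h : ExtClosure Q X)
    (hQ : ∀ Y, Q Y → ∃ j, Nonempty (Y ≅ D.Δ j)) : Filt D X := by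
  induction h with
  | of X h =>
    obtain ⟨j, ⟨e⟩⟩ := hQ X h
    have hse := shortExact_mono (0 : (0 : C) ⟶ X)
    exact Filt.step _ hse j (cokernelZeroIsoTarget ≪≫ e) (.zero _ (isZero_zero C))
  | zero X h => exact .zero _ h
  | ext S hS _ _ h1 h3 => exact h1.ext h3 _ S.f S.g S.zero hS

/-! ### Ext from projectives -/

lemma finrank_Ext_zero (P Y : C) [Projective P] :
    Module.finrank k (((Ext k C 0).obj (Opposite.op P)).obj Y) = Module.finrank k (P ⟶ Y) := by
  let F := ((linearYoneda k C).obj Y).rightOp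
  have e : (F.leftDerived 0).obj P ≅ F.obj P := asIso (F.fromLeftDerivedZero.app P)
  exact e.unop.symm.toLinearEquiv.finrank_eq

lemma finsum_Ext (P Y : C) [Projective P] :
    ∑ᶠ r : ℕ, ((-1 : ℤ) ^ r *
      (Module.finrank k (((Ext k C r).obj (Opposite.op P)).obj Y) : ℤ)) =
      (Module.finrank k (P ⟶ Y) : ℤ) := by
  rw [finsum_eq_single _ 0]
  · rw [finrank_Ext_zero]; simp
  · intro r hr
    obtain ⟨s, rfl⟩ := Nat.exists_eq_succ_of_ne_zero hr
    have h := isZero_Ext_succ_of_projective (R := k) P Y s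
    have := ModuleCat.subsingleton_of_isZero h
    rw [Module.finrank_zero_of_subsingleton]
    simp

/-- **Bernstein–Gelfand–Gelfand reciprocity.** If `A` is highest weight then each `P i`
admits a filtration by standard objects, and for any such filtration the multiplicity
`(P i : Δ j)` of `Δ j` among its factors satisfies
`(P i : Δ j) = χ([P i], [∇ j]) = [∇ j : S i]`. -/
theorem bgg_reciprocity (D : DeligneData k C n) (hhw : D.IsHighestWeight) (i : Fin n) :
    Nonempty (StandardFiltration D (D.P i)) ∧
    ∀ (filt : StandardFiltration D (D.P i)) (j : Fin n),
      (((Finset.univ.filter (fun l => filt.idx l = j)).card : ℤ) =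
        ∑ᶠ r : ℕ, ((-1 : ℤ) ^ r *
          (Module.finrank k (((Ext k C r).obj (Opposite.op (D.P i))).obj (D.nabla j)) : ℤ))) ∧
      (Finset.univ.filter (fun l => filt.idx l = j)).card = D.mult (D.nabla j) i := by
  refine ⟨(Filt.of_extClosure (hhw i).2 fun Y ⟨j, _, h⟩ => ⟨j, h⟩).nonempty, fun filt j => ?_⟩
  have := (D.projCover i).1
  rw [finsum_Ext, D.card_eq hhw _ filt j, D.finrank_P_s6]
  exact ⟨rfl, rfl⟩

end HWPaper
end
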